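/- Let H₁, H₂ be complex Hilbert spaces, K : H₁ → H₂ a bounded linear operator, α > 0, γ ∈ (0,1], R > 0, and β = (K*K)^γ ψ for some ψ ∈ H₁ with ‖ψ‖² ≤ R. Let (Ω, P) be a probability space and let K̂ : Ω → B(H₁,H₂) and r̂ : Ω → H₂ be strongly measurable maps such that, with r = Kβ, E‖r̂ − r‖² ≤ η₁/T and E‖K̂ − K‖²_op ≤ η₂/T for constants η₁, η₂ ≥ 0 and T > 0. Define the Tikhonov-regularized estimator ω ↦ β̂(ω) = (α I + K̂(ω)* K̂(ω))⁻¹ K̂(ω)* r̂(ω) (the inverse exists since K̂*K̂ is nonnegative self-adjoint and α > 0). Assume ω ↦ ‖β̂(ω) − β‖² is integrable. Then E‖β̂ − β‖² ≤ 8(η₁ + η₂‖β‖²)/(αT) + (4Rη₂/(αT))·(α^{2γ} + α^{min(2γ,1)}·‖K*K‖^{max(2γ−1,0)}) + 4α^{2γ} R. -/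

import Mathlib

open MeasureTheory ContinuousLinearMap

lemma Real.mul_rpow_div_add_le {a x s : ℝ} (ha : 0 < a) (hx : 0 ≤ x) (hs₀ : 0 ≤ s) (hs₁ : s ≤ 1) :
    a * x ^ s / (a + x) ≤ a ^ s := by
  have h := Real.geom_mean_le_arith_mean2_weighted (sub_nonneg.2 hs₁) hs₀ ha.le hx (by ring)
  have h' : a ^ (1 - s) * x ^ s ≤ a + x := by nlinarith
  rw [div_le_iff₀ (by positivity)]
  calc a * x ^ s = a ^ s * (a ^ (1 - s) * x ^ s) := by
        rw [← mul_assoc, ← Real.rpow_add ha]; simp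
    _ ≤ a ^ s * (a + x) := by gcongr

lemma Real.mul_sq_mul_rpow_div_add_le {a x M s : ℝ} (ha : 0 < a) (hx : 0 ≤ x) (hxM : x ≤ M)
    (hs : 0 ≤ s) :
    x * (a * x ^ s / (a + x)) ^ 2 ≤ a * (a ^ min (2 * s) 1 * M ^ max (2 * s - 1) 0) := by
  have hpow {y t : ℝ} (hy : 0 ≤ y) : (y ^ t) ^ 2 = y ^ (2 * t) := by
    rw [← Real.rpow_natCast, ← Real.rpow_mul hy]; norm_num [mul_comm]
  rcases le_total (2 * s) 1 with h | h
  · rw [min_eq_left h, max_eq_right (by linarith), Real.rpow_zero, mul_one]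
    have h1 := Real.mul_rpow_div_add_le ha hx (s := s + 1 / 2) (by linarith) (by linarith)
    calc x * (a * x ^ s / (a + x)) ^ 2 = (a * x ^ (s + 1 / 2) / (a + x)) ^ 2 := by
          rw [Real.rpow_add_of_nonneg hx hs (by norm_num), ← Real.sqrt_eq_rpow]
          simp only [div_pow, mul_pow, Real.sq_sqrt hx]
          ring
      _ ≤ (a ^ (s + 1 / 2)) ^ 2 := by gcongr
      _ = a * a ^ (2 * s) := by
          rw [hpow ha.le, mul_add, Real.rpow_add ha, mul_comm]; norm_num
  · rw [min_eq_right h, max_eq_left (by linarith), Real.rpow_one]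
    have hxs : (x ^ s) ^ 2 = x * x ^ (2 * s - 1) := by
      rw [hpow hx]
      conv_rhs => enter [1]; rw [← Real.rpow_one x]
      rw [← Real.rpow_add_of_nonneg hx zero_le_one (by linarith)]
      ring_nf
    calc x * (a * x ^ s / (a + x)) ^ 2
        = a * (a * x ^ (2 * s - 1)) * (x / (a + x)) ^ 2 := by
          rw [div_pow, mul_pow, hxs, div_pow]; ring
      _ ≤ a * (a * x ^ (2 * s - 1)) * 1 ^ 2 := by
          gcongr
          rw [div_le_one (by positivity)]; linarith
      _ ≤ a * (a * M ^ (2 * s - 1)) := by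
          rw [one_pow, mul_one]
          gcongr

section

variable {E F : Type*} [NormedAddCommGroup E] [InnerProductSpace ℂ E] [CompleteSpace E]
  [NormedAddCommGroup F] [InnerProductSpace ℂ F] [CompleteSpace F]

lemma ContinuousLinearMap.adjoint_comp_self_nonneg (B : E →L[ℂ] F) : 0 ≤ adjoint B ∘L B :=
  (ContinuousLinearMap.nonneg_iff_isPositive _).2 (isPositive_adjoint_comp_self B)

lemma ContinuousLinearMap.isUnit_smul_one_add_adjoint_comp_self (B : E →L[ℂ] F) {a : ℝ}
    (ha : 0 < a) : IsUnit ((a : ℂ) • (1 : E →L[ℂ] E) + adjoint B ∘L B) := by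
  have h : IsStrictlyPositive ((a : ℝ) • (1 : E →L[ℂ] E)) := by
    exact IsStrictlyPositive.smul ha isStrictlyPositive_one
  have := (h.add_nonneg B.adjoint_comp_self_nonneg).isUnit
  simpa using this

/-- A priori bound for the regularized normal equation. -/
lemma ContinuousLinearMap.norm_sq_le_of_regularized_eq (B : E →L[ℂ] F) {a : ℝ} (ha : 0 < a)
    {x v : E} {y : F} (h : (a : ℂ) • x + adjoint B (B x) = adjoint B y + v) :
    ‖x‖ ^ 2 ≤ ‖y‖ ^ 2 / (2 * a) + ‖v‖ ^ 2 / a ^ 2 := by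
  have h1 := congrArg (fun u => RCLike.re (inner ℂ u x)) h
  simp only [inner_add_left, adjoint_inner_left, map_add, inner_smul_left,
    inner_self_eq_norm_sq_to_K] at h1
  have h2 : a * ‖x‖ ^ 2 + ‖B x‖ ^ 2 = RCLike.re (inner ℂ y (B x)) + RCLike.re (inner ℂ v x) := by
    rw [← h1]
    simp [← Complex.ofReal_pow]
  have h3 : RCLike.re (inner ℂ y (B x)) ≤ ‖y‖ * ‖B x‖ := re_inner_le_norm y (B x)
  have h4 : RCLike.re (inner ℂ v x) ≤ ‖v‖ * ‖x‖ := re_inner_le_norm v x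
  have h5 : a * ‖x‖ ^ 2 ≤ ‖y‖ ^ 2 / 4 + ‖v‖ * ‖x‖ := by
    nlinarith [sq_nonneg (‖y‖ / 2 - ‖B x‖)]
  have h6 : a ^ 2 * ‖x‖ ^ 2 ≤ a * (‖y‖ ^ 2 / 4 + ‖v‖ * ‖x‖) := by
    calc a ^ 2 * ‖x‖ ^ 2 = a * (a * ‖x‖ ^ 2) := by ring
      _ ≤ _ := by gcongr
  have h7 : ‖x‖ ^ 2 * a ^ 2 ≤ a * ‖y‖ ^ 2 / 2 + ‖v‖ ^ 2 := by
    nlinarith [sq_nonneg (‖v‖ - a * ‖x‖)]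
  calc ‖x‖ ^ 2 ≤ (a * ‖y‖ ^ 2 / 2 + ‖v‖ ^ 2) / a ^ 2 := (le_div_iff₀ (by positivity)).2 h7
    _ = _ := by field_simp

/-- The bias vector `a (a + K*K)⁻¹ (K*K)^s ψ` and its norm bounds. -/
lemma ContinuousLinearMap.exists_regularization_bias (K : E →L[ℂ] F) {a s : ℝ} (ha : 0 < a)
    (hs₀ : 0 ≤ s) (hs₁ : s ≤ 1) (ψ : E) :
    ∃ z : E, (a : ℂ) • z + adjoint K (K z) =
        (a : ℂ) • cfc (fun x : ℝ => x ^ s) (adjoint K ∘L K) ψ ∧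
      ‖z‖ ^ 2 ≤ a ^ (2 * s) * ‖ψ‖ ^ 2 ∧
      ‖K z‖ ^ 2 ≤ a * (a ^ min (2 * s) 1 * ‖adjoint K ∘L K‖ ^ max (2 * s - 1) 0) * ‖ψ‖ ^ 2 := by
  set A : E →L[ℂ] E := adjoint K ∘L K
  have hA₀ : 0 ≤ A := K.adjoint_comp_self_nonneg
  have hAs : IsSelfAdjoint A := .of_nonneg hA₀
  have hspec : ∀ x ∈ spectrum ℝ A, 0 ≤ x := fun x hx => spectrum_nonneg_of_nonneg hA₀ hx
  have hspec' : ∀ x ∈ spectrum ℝ A, x ≤ ‖A‖ := fun x hx =>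
    (le_abs_self x).trans <| (spectrum.norm_le_norm_mul_of_mem hx).trans <|
      mul_le_of_le_one_right (norm_nonneg A) norm_id_le
  set f : ℝ → ℝ := fun x => a * x ^ s / (a + x) with hf
  have hpow : ContinuousOn (fun x : ℝ => x ^ s) (spectrum ℝ A) :=
    (Real.continuous_rpow_const hs₀).continuousOn
  have hfc : ContinuousOn f (spectrum ℝ A) :=
    (continuousOn_const.mul hpow).div (by fun_prop) fun x hx => by
      have := hspec x hx
      positivity
  have hfs : IsSelfAdjoint (cfc f A) := cfc_predicate f A
  have hAz (u : E) : A u = adjoint K (K u) := rfl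
  refine ⟨cfc f A ψ, ?_, ?_, ?_⟩
  · have h : a • cfc f A + A * cfc f A = a • cfc (fun x : ℝ => x ^ s) A := by
      have hAf : A * cfc f A = cfc (fun x => x * f x) A := by
        rw [cfc_mul (fun x => x) f A continuousOn_id hfc, cfc_id' ℝ A hAs]
      rw [hAf, ← cfc_smul a f A hfc, ← cfc_smul a _ A hpow,
        ← cfc_add A (fun x => a • f x) (fun x => x * f x) (hfc.const_smul a)
          (continuousOn_id.mul hfc)]
      refine cfc_congr fun x hx => ?_
      have := hspec x hx
      simp only [hf, smul_eq_mul]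
      field_simp
    have := congrArg (fun L : E →L[ℂ] E => L ψ) h
    simpa [hAz] using this
  · have h : ‖cfc f A‖ ≤ a ^ s := norm_cfc_le (by positivity) fun x hx => by
      have hx₀ := hspec x hx
      rw [Real.norm_of_nonneg (by positivity)]
      exact Real.mul_rpow_div_add_le ha hx₀ hs₀ hs₁
    calc ‖cfc f A ψ‖ ^ 2 ≤ (a ^ s * ‖ψ‖) ^ 2 := by
          gcongr
          exact (cfc f A).le_of_opNorm_le h ψ
      _ = _ := by
          rw [mul_pow, ← Real.rpow_natCast, ← Real.rpow_mul ha.le]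
          norm_num [mul_comm]
  · have hG : cfc f A * A * cfc f A = cfc (fun x => x * f x ^ 2) A := by
      have hfA : cfc f A * A = cfc (fun x => f x * x) A := by
        rw [cfc_mul f (fun x => x) A hfc continuousOn_id, cfc_id' ℝ A hAs]
      rw [hfA, ← cfc_mul (fun x => f x * x) f A (hfc.mul continuousOn_id) hfc]
      exact cfc_congr fun x _ => by ring
    have h : ‖cfc (fun x => x * f x ^ 2) A‖ ≤
        a * (a ^ min (2 * s) 1 * ‖A‖ ^ max (2 * s - 1) 0) :=
      norm_cfc_le (by positivity) fun x hx => by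
        have hx₀ := hspec x hx
        rw [Real.norm_of_nonneg (by positivity)]
        exact Real.mul_sq_mul_rpow_div_add_le ha hx₀ (hspec' x hx) hs₀
    calc ‖K (cfc f A ψ)‖ ^ 2 = RCLike.re (inner ℂ ((cfc f A * A * cfc f A) ψ) ψ) := by
          rw [apply_norm_sq_eq_inner_adjoint_left]
          change _ = RCLike.re (inner ℂ (cfc f A (A (cfc f A ψ))) ψ)
          rw [← adjoint_inner_right (cfc f A), hfs.adjoint_eq]
      _ ≤ ‖(cfc f A * A * cfc f A) ψ‖ * ‖ψ‖ := re_inner_le_norm _ _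
      _ ≤ (a * (a ^ min (2 * s) 1 * ‖A‖ ^ max (2 * s - 1) 0) * ‖ψ‖) * ‖ψ‖ := by
          rw [hG]
          gcongr
          exact ContinuousLinearMap.le_of_opNorm_le _ h ψ
      _ = _ := by ring

/-- Deterministic error bound for the regularized solution of a perturbed equation. -/
lemma ContinuousLinearMap.norm_sub_sq_le_of_regularized_eq (K B : E →L[ℂ] F) {a : ℝ} (ha : 0 < a)
    {x b z : E} {y : F} (hx : (a : ℂ) • x + adjoint B (B x) = adjoint B y)
    (hz : (a : ℂ) • z + adjoint K (K z) = (a : ℂ) • b) :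
    ‖x - b‖ ^ 2 ≤ 3 / a * ‖y - K b‖ ^ 2 +
      (3 / a * (‖b‖ ^ 2 + ‖z‖ ^ 2) + 2 / a ^ 2 * ‖K z‖ ^ 2) * ‖B - K‖ ^ 2 + 2 * ‖z‖ ^ 2 := by
  set D := B - K with hD
  set u := (y - K b) - D b + D z with hu
  have hw : (a : ℂ) • (x - b + z) + adjoint B (B (x - b + z)) =
      adjoint B u + adjoint D (K z) := by
    have hz' : (a : ℂ) • z = (a : ℂ) • b - adjoint K (K z) := eq_sub_of_add_eq hz
    have hx' : (a : ℂ) • x = adjoint B y - adjoint B (B x) := eq_sub_of_add_eq hx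
    simp only [hu, hD, smul_add, smul_sub, hz', hx', map_add, map_sub, sub_apply]
    abel
  have h1 := B.norm_sq_le_of_regularized_eq ha hw
  have hv : ‖adjoint D (K z)‖ ^ 2 ≤ ‖D‖ ^ 2 * ‖K z‖ ^ 2 := by
    rw [← mul_pow]
    gcongr
    simpa using (adjoint D).le_opNorm (K z)
  have hu' : ‖u‖ ^ 2 ≤ 3 * (‖y - K b‖ ^ 2 + ‖D‖ ^ 2 * ‖b‖ ^ 2 + ‖D‖ ^ 2 * ‖z‖ ^ 2) := by
    have : ‖u‖ ≤ ‖y - K b‖ + ‖D‖ * ‖b‖ + ‖D‖ * ‖z‖ :=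
      (norm_add_le _ _).trans (add_le_add ((norm_sub_le _ _).trans
        (add_le_add le_rfl (D.le_opNorm b))) (D.le_opNorm z))
    calc ‖u‖ ^ 2 ≤ (‖y - K b‖ + ‖D‖ * ‖b‖ + ‖D‖ * ‖z‖) ^ 2 := by gcongr
      _ ≤ _ := by
        nlinarith [sq_nonneg (‖y - K b‖ - ‖D‖ * ‖b‖), sq_nonneg (‖y - K b‖ - ‖D‖ * ‖z‖),
          sq_nonneg (‖D‖ * ‖b‖ - ‖D‖ * ‖z‖)]
  have h2 : ‖x - b‖ ^ 2 ≤ 2 * ‖x - b + z‖ ^ 2 + 2 * ‖z‖ ^ 2 := by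
    have : ‖x - b‖ ≤ ‖x - b + z‖ + ‖z‖ := by simpa using norm_sub_le (x - b + z) z
    calc ‖x - b‖ ^ 2 ≤ (‖x - b + z‖ + ‖z‖) ^ 2 := by gcongr
      _ ≤ _ := by nlinarith [sq_nonneg (‖x - b + z‖ - ‖z‖)]
  calc ‖x - b‖ ^ 2 ≤ 2 * (‖u‖ ^ 2 / (2 * a) + ‖adjoint D (K z)‖ ^ 2 / a ^ 2) + 2 * ‖z‖ ^ 2 := by
        linarith
    _ ≤ 2 * (3 * (‖y - K b‖ ^ 2 + ‖D‖ ^ 2 * ‖b‖ ^ 2 + ‖D‖ ^ 2 * ‖z‖ ^ 2) / (2 * a) +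
          ‖D‖ ^ 2 * ‖K z‖ ^ 2 / a ^ 2) + 2 * ‖z‖ ^ 2 := by gcongr
    _ = _ := by field_simp; ring

end

/-- Theorem 1 (abstract form): convergence rate of the Tikhonov-regularized estimator.
With the source condition `β = (K*K)^γ ψ`, `‖ψ‖² ≤ R`, and variance bounds
`E‖r̂ − r‖² ≤ η₁/T`, `E‖K̂ − K‖² ≤ η₂/T`, the estimator
`β̂ = (α I + K̂*K̂)⁻¹ K̂* r̂` satisfies
`E‖β̂ − β‖² ≤ 8(η₁ + η₂‖β‖²)/(αT) + (4Rη₂/(αT))(α^{2γ} + α^{min(2γ,1)} ‖K*K‖^{max(2γ−1,0)})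
  + 4 α^{2γ} R`. -/
theorem stmt_0 {H₁ H₂ : Type*} [NormedAddCommGroup H₁] [InnerProductSpace ℂ H₁]
    [CompleteSpace H₁] [NormedAddCommGroup H₂] [InnerProductSpace ℂ H₂] [CompleteSpace H₂]
    (K : H₁ →L[ℂ] H₂) (α γ R : ℝ) (hα : 0 < α) (hγ : γ ∈ Set.Ioc (0 : ℝ) 1) (hR : 0 < R)
    (ψ β : H₁) (hβ : β = cfc (fun x : ℝ => x ^ γ) (adjoint K ∘L K) ψ) (hψ : ‖ψ‖ ^ 2 ≤ R)
    {Ω : Type*} [MeasurableSpace Ω] (P : Measure Ω) [IsProbabilityMeasure P]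
    (Khat : Ω → (H₁ →L[ℂ] H₂)) (rhat : Ω → H₂)
    (hKhat_meas : AEStronglyMeasurable Khat P) (hrhat_meas : AEStronglyMeasurable rhat P)
    (η₁ η₂ T : ℝ) (hη₁ : 0 ≤ η₁) (hη₂ : 0 ≤ η₂) (hT : 0 < T)
    (hr_int : Integrable (fun ω => ‖rhat ω - K β‖ ^ 2) P)
    (hK_int : Integrable (fun ω => ‖Khat ω - K‖ ^ 2) P)
    (hr_var : ∫ ω, ‖rhat ω - K β‖ ^ 2 ∂P ≤ η₁ / T)
    (hK_var : ∫ ω, ‖Khat ω - K‖ ^ 2 ∂P ≤ η₂ / T)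
    (βhat : Ω → H₁)
    (hβhat : ∀ ω, βhat ω =
      Ring.inverse ((α : ℂ) • (1 : H₁ →L[ℂ] H₁) + adjoint (Khat ω) ∘L Khat ω)
        (adjoint (Khat ω) (rhat ω)))
    (hβhat_int : Integrable (fun ω => ‖βhat ω - β‖ ^ 2) P) :
    ∫ ω, ‖βhat ω - β‖ ^ 2 ∂P ≤
      8 * (η₁ + η₂ * ‖β‖ ^ 2) / (α * T) +
        4 * R * η₂ / (α * T) *
          (α ^ (2 * γ) + α ^ min (2 * γ) 1 * ‖adjoint K ∘L K‖ ^ max (2 * γ - 1) 0) +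
        4 * α ^ (2 * γ) * R := by
  obtain ⟨z, hz, hz₁, hz₂⟩ := K.exists_regularization_bias hα hγ.1.le hγ.2 ψ
  rw [← hβ] at hz
  set N := α ^ min (2 * γ) 1 * ‖adjoint K ∘L K‖ ^ max (2 * γ - 1) 0
  have hN₀ : 0 ≤ N := by positivity
  replace hz₁ : ‖z‖ ^ 2 ≤ α ^ (2 * γ) * R := hz₁.trans (by gcongr)
  replace hz₂ : ‖K z‖ ^ 2 ≤ α * N * R := hz₂.trans (by gcongr)
  set C := 3 / α * (‖β‖ ^ 2 + ‖z‖ ^ 2) + 2 / α ^ 2 * ‖K z‖ ^ 2 with hC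
  have hC₀ : 0 ≤ C := by positivity
  have hpt (ω : Ω) : ‖βhat ω - β‖ ^ 2 ≤
      3 / α * ‖rhat ω - K β‖ ^ 2 + C * ‖Khat ω - K‖ ^ 2 + 2 * ‖z‖ ^ 2 := by
    refine K.norm_sub_sq_le_of_regularized_eq (Khat ω) hα ?_ hz
    have h := congrArg (fun L : H₁ →L[ℂ] H₁ => L (adjoint (Khat ω) (rhat ω)))
      (Ring.mul_inverse_cancel _ ((Khat ω).isUnit_smul_one_add_adjoint_comp_self hα))
    rw [hβhat ω]
    simpa using h
  have hC₁ : C ≤ 3 / α * (‖β‖ ^ 2 + α ^ (2 * γ) * R) + 2 / α ^ 2 * (α * N * R) := by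
    rw [hC]
    gcongr
  have hi₁ := hr_int.const_mul (3 / α)
  have hi₂ := hK_int.const_mul C
  have hα₂ : 0 ≤ α ^ (2 * γ) := by positivity
  have hRη : 0 ≤ R * η₂ / (α * T) := by positivity
  calc ∫ ω, ‖βhat ω - β‖ ^ 2 ∂P
      ≤ ∫ ω, (3 / α * ‖rhat ω - K β‖ ^ 2 + C * ‖Khat ω - K‖ ^ 2 + 2 * ‖z‖ ^ 2) ∂P :=
        integral_mono hβhat_int ((hi₁.add hi₂).add (integrable_const _)) hpt
    _ = 3 / α * ∫ ω, ‖rhat ω - K β‖ ^ 2 ∂P + C * ∫ ω, ‖Khat ω - K‖ ^ 2 ∂P + 2 * ‖z‖ ^ 2 := by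
        rw [integral_add (by exact hi₁.add hi₂) (integrable_const _), integral_add hi₁ hi₂,
          integral_const_mul, integral_const_mul]
        simp
    _ ≤ 3 / α * (η₁ / T) + (3 / α * (‖β‖ ^ 2 + α ^ (2 * γ) * R) + 2 / α ^ 2 * (α * N * R)) *
          (η₂ / T) + 2 * (α ^ (2 * γ) * R) := by
        gcongr
    _ = 3 * (η₁ / (α * T)) + 3 * (η₂ * ‖β‖ ^ 2 / (α * T)) +
          R * η₂ / (α * T) * (3 * α ^ (2 * γ) + 2 * N) + 2 * (α ^ (2 * γ) * R) := by
        field_simp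
        ring
    _ ≤ 8 * (η₁ / (α * T)) + 8 * (η₂ * ‖β‖ ^ 2 / (α * T)) +
          R * η₂ / (α * T) * (4 * α ^ (2 * γ) + 4 * N) + 4 * (α ^ (2 * γ) * R) := by
        gcongr <;> norm_num
    _ = _ := by ring
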